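/- For a positive integer N and α ∈ (0,1), define Γ(N) = sup (1/N) ∑_{k,ℓ=1}^N gcd(n_k, n_ℓ)^{2α} / (n_k n_ℓ)^α, where the supremum is over all choices of N distinct positive integers n_1, …, n_N. Then there exists an absolute constant C > 0 such that for all α in the interval (log 2 / log 3, 1) and all N ≥ 2, Γ(N) ≤ exp( (C/(1−α)) (log N)^{1−α} ). -/

import Mathlib

open MeasureTheory Filter Real

namespace GcdSum

/-- weights depending on the parity -/
noncomputable def hp (c s : ℝ) (d : ℕ) : ℝ := if Even d then c else s

lemma hp_succ (c s : ℝ) (d : ℕ) : hp c s (d + 1) = hp s c d := by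
  unfold hp
  by_cases h : Even d
  · have : ¬ Even (d + 1) := by rw [Nat.even_add_one]; simpa using h
    simp [h, this]
  · have : Even (d + 1) := by rw [Nat.even_add_one]; simpa using h
    simp [h, this]

lemma hp_nonneg {c s : ℝ} (hc : 0 ≤ c) (hs : 0 ≤ s) (d : ℕ) : 0 ≤ hp c s d := by
  unfold hp; split_ifs <;> assumption

lemma half_sum (x : ℝ) (hx0 : 0 < x) (hx1 : x < 1) (n : ℕ) :
    ∀ c s : ℝ, 0 ≤ c → 0 ≤ s →
      ∑ d ∈ Finset.range n, hp c s d * x ^ d ≤ (c + s * x) / (1 - x ^ 2) := by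
  have h1 : 0 < 1 - x ^ 2 := by nlinarith
  induction n with
  | zero => intro c s hc hs; simp; positivity
  | succ n ih =>
    intro c s hc hs
    rw [Finset.sum_range_succ']
    have e : ∑ d ∈ Finset.range n, hp c s (d + 1) * x ^ (d + 1)
        = x * ∑ d ∈ Finset.range n, hp s c d * x ^ d := by
      rw [Finset.mul_sum]
      refine Finset.sum_congr rfl fun d _ => ?_
      rw [hp_succ]; ring
    rw [e]
    have h2 := mul_le_mul_of_nonneg_left (ih s c hs hc) hx0.le
    have h3 : hp c s 0 * x ^ 0 = c := by simp [hp]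
    rw [h3]
    calc _ ≤ x * ((s + c * x) / (1 - x ^ 2)) + c := by linarith
      _ = _ := by field_simp; ring

lemma row_sum (x : ℝ) (hx0 : 0 < x) (hx1 : x < 1) (M k : ℕ) (c s : ℝ) (hc : 0 ≤ c) (hs : 0 ≤ s) :
    ∑ j ∈ Finset.range M, hp c s (j + k) * x ^ (Nat.dist j k)
      ≤ c * ((1 + x ^ 2) / (1 - x ^ 2)) + s * (2 * x / (1 - x ^ 2)) := by
  have h1 : 0 < 1 - x ^ 2 := by nlinarith
  have hle : ∑ j ∈ Finset.range M, hp c s (j + k) * x ^ (Nat.dist j k)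
      ≤ ∑ j ∈ Finset.range (k + M), hp c s (j + k) * x ^ (Nat.dist j k) := by
    apply Finset.sum_le_sum_of_subset_of_nonneg
    · intro j hj; simp at hj ⊢; omega
    · intro j _ _
      exact mul_nonneg (hp_nonneg hc hs _) (by positivity)
  refine hle.trans ?_
  rw [Finset.sum_range_add]
  have ha : ∑ j ∈ Finset.range M, hp c s (k + j + k) * x ^ (Nat.dist (k + j) k)
      ≤ (c + s * x) / (1 - x ^ 2) := by
    refine le_trans (le_of_eq ?_) (half_sum x hx0 hx1 M c s hc hs)
    refine Finset.sum_congr rfl fun j _ => ?_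
    have e1 : Nat.dist (k + j) k = j := by unfold Nat.dist; omega
    have e2 : Even (k + j + k) ↔ Even j := by
      rw [show k + j + k = j + 2 * k by ring]; simp [Nat.even_add]
    rw [e1]; simp [hp, e2]
  have hb : ∑ j ∈ Finset.range k, hp c s (j + k) * x ^ (Nat.dist j k)
      ≤ x * ((s + c * x) / (1 - x ^ 2)) := by
    refine le_trans (le_of_eq ?_) (mul_le_mul_of_nonneg_left (half_sum x hx0 hx1 k s c hs hc) hx0.le)
    rw [← Finset.sum_range_reflect, Finset.mul_sum]
    refine Finset.sum_congr rfl fun j hj => ?_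
    have hj : j < k := by simpa using hj
    have e1 : Nat.dist (k - 1 - j) k = j + 1 := by unfold Nat.dist; omega
    have e2 : Even (k - 1 - j + k) ↔ Even (j + 1) := by
      simp only [Nat.even_iff]; omega
    have e3 : hp c s (k - 1 - j + k) = hp s c j := by
      rw [← hp_succ c s j]; simp only [hp, e2]
    rw [e1, e3]; ring
  calc _ ≤ x * ((s + c * x) / (1 - x ^ 2)) + (c + s * x) / (1 - x ^ 2) := add_le_add hb ha
    _ = _ := by field_simp; ring

/-- the parameter `t` -/
noncomputable def tt (x : ℝ) : ℝ := Real.log ((1 + x) / (1 - x))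

lemma exp_tt (x : ℝ) (hx0 : 0 < x) (hx1 : x < 1) : Real.exp (tt x) = (1 + x) / (1 - x) := by
  have : 0 < 1 - x := by linarith
  exact Real.exp_log (by positivity)

lemma cosh_tt (x : ℝ) (hx0 : 0 < x) (hx1 : x < 1) :
    Real.cosh (tt x) = (1 + x ^ 2) / (1 - x ^ 2) := by
  have : 0 < 1 - x := by linarith
  have : (1 - x) ≠ 0 := by linarith
  have : (1 + x) ≠ 0 := by linarith
  rw [Real.cosh_eq, Real.exp_neg, exp_tt x hx0 hx1, show 1 - x ^ 2 = (1 - x) * (1 + x) by ring]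
  field_simp; ring

lemma sinh_tt (x : ℝ) (hx0 : 0 < x) (hx1 : x < 1) :
    Real.sinh (tt x) = 2 * x / (1 - x ^ 2) := by
  have : 0 < 1 - x := by linarith
  have : (1 - x) ≠ 0 := by linarith
  have : (1 + x) ≠ 0 := by linarith
  rw [Real.sinh_eq, Real.exp_neg, exp_tt x hx0 hx1, show 1 - x ^ 2 = (1 - x) * (1 + x) by ring]
  field_simp; ring

lemma tt_nonneg (x : ℝ) (hx0 : 0 < x) (hx1 : x < 1) : 0 ≤ tt x := by
  apply Real.log_nonneg
  rw [le_div_iff₀] <;> linarith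

lemma tt_le (x : ℝ) (hx0 : 0 < x) (hx1 : x ≤ 7 / 10) : tt x ≤ 7 * x := by
  have : 0 < 1 - x := by linarith
  have h := Real.log_le_sub_one_of_pos (show 0 < (1 + x) / (1 - x) by positivity)
  refine h.trans ?_
  rw [sub_le_iff_le_add, div_le_iff₀ this]; nlinarith

/-- the comparison kernel -/
noncomputable def hq (x : ℝ) (q d : ℕ) : ℝ := hp (Real.cosh (q * tt x)) (Real.sinh (q * tt x)) d

lemma hq_nonneg (x : ℝ) (hx0 : 0 < x) (hx1 : x < 1) (q d : ℕ) : 0 ≤ hq x q d := by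
  have := tt_nonneg x hx0 hx1
  exact hp_nonneg (Real.cosh_pos _).le (Real.sinh_nonneg_iff.2 (by positivity)) d

lemma hq_le (x : ℝ) (q d : ℕ) : hq x q d ≤ Real.cosh (q * tt x) := by
  unfold hq hp; split_ifs
  · exact le_rfl
  · exact (Real.sinh_lt_cosh _).le

lemma hq_step (x : ℝ) (hx0 : 0 < x) (hx1 : x < 1) (q M i k : ℕ) :
    ∑ j ∈ Finset.range M, hq x q (i + j) * x ^ (Nat.dist j k) ≤ hq x (q + 1) (i + k) := by
  have ht := tt_nonneg x hx0 hx1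
  have hc := (Real.cosh_pos (q * tt x)).le
  have hs : 0 ≤ Real.sinh (q * tt x) := Real.sinh_nonneg_iff.2 (by positivity)
  by_cases h : Even (i + k)
  · have e : ∀ j, hq x q (i + j) = hp (Real.cosh (q * tt x)) (Real.sinh (q * tt x)) (j + k) := by
      intro j
      have : Even (i + j) ↔ Even (j + k) := by
        simp only [Nat.even_iff] at h ⊢; omega
      simp only [hq, hp, this]
    simp only [e]
    refine (row_sum x hx0 hx1 M k _ _ hc hs).trans (le_of_eq ?_)
    rw [← cosh_tt x hx0 hx1, ← sinh_tt x hx0 hx1, hq, hp, if_pos h]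
    push_cast
    rw [add_mul, one_mul, Real.cosh_add]
  · have e : ∀ j, hq x q (i + j) = hp (Real.sinh (q * tt x)) (Real.cosh (q * tt x)) (j + k) := by
      intro j
      have : Even (i + j) ↔ ¬ Even (j + k) := by
        simp only [Nat.even_iff] at h ⊢; omega
      simp only [hq, hp, this]
      split_ifs <;> simp_all
    simp only [e]
    refine (row_sum x hx0 hx1 M k _ _ hs hc).trans (le_of_eq ?_)
    rw [← cosh_tt x hx0 hx1, ← sinh_tt x hx0 hx1, hq, hp, if_neg h]
    push_cast
    rw [add_mul, one_mul, Real.sinh_add]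

section mat
variable {κ ι : Type*} [Fintype κ] [DecidableEq κ] [Fintype ι] [DecidableEq ι]

/-- the GCD matrix -/
noncomputable def GG (x : ι → ℝ) (v : κ → ι → ℕ) : Matrix κ κ ℝ :=
  fun k l => ∏ i, x i ^ (Nat.dist (v k i) (v l i))

lemma sum_le_prod (v : κ → ι → ℕ) (hv : Function.Injective v) (M : ℕ) (hM : ∀ k i, v k i < M)
    (g : ι → ℕ → ℝ) (hg : ∀ i j, 0 ≤ g i j) :
    ∑ m, ∏ i, g i (v m i) ≤ ∏ i, ∑ j ∈ Finset.range M, g i j := by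
  rw [Finset.prod_univ_sum]
  rw [← Finset.sum_image (s := Finset.univ) (g := v) (f := fun w : ι → ℕ => ∏ i, g i (w i))
    (fun a _ b _ h => hv h)]
  apply Finset.sum_le_sum_of_subset_of_nonneg
  · intro w hw
    simp only [Finset.mem_image, Finset.mem_univ, true_and] at hw
    obtain ⟨k, rfl⟩ := hw
    simpa using hM k
  · intro w _ _
    exact Finset.prod_nonneg fun i _ => hg _ _

lemma GG_pow_le (x : ι → ℝ) (hx0 : ∀ i, 0 < x i) (hx1 : ∀ i, x i < 1) (v : κ → ι → ℕ)
    (hv : Function.Injective v) (M : ℕ) (hM : ∀ k i, v k i < M) (q : ℕ) :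
    ∀ k l, (GG x v ^ q) k l ≤ ∏ i, hq (x i) q (v k i + v l i) := by
  induction q with
  | zero =>
    intro k l
    rw [pow_zero, Matrix.one_apply]
    split_ifs with h
    · subst h
      simp [hq, hp]
    · exact Finset.prod_nonneg fun i _ => hq_nonneg _ (hx0 i) (hx1 i) _ _
  | succ q ih =>
    intro k l
    rw [pow_succ, Matrix.mul_apply]
    calc ∑ m, (GG x v ^ q) k m * GG x v m l
        ≤ ∑ m, (∏ i, hq (x i) q (v k i + v m i)) * ∏ i, x i ^ (Nat.dist (v m i) (v l i)) := by
          refine Finset.sum_le_sum fun m _ => ?_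
          exact mul_le_mul_of_nonneg_right (ih k m)
            (Finset.prod_nonneg fun i _ => pow_nonneg (hx0 i).le _)
      _ = ∑ m, ∏ i, (hq (x i) q (v k i + v m i) * x i ^ (Nat.dist (v m i) (v l i))) := by
          simp only [Finset.prod_mul_distrib]
      _ ≤ ∏ i, ∑ j ∈ Finset.range M, hq (x i) q (v k i + j) * x i ^ (Nat.dist j (v l i)) := by
          exact sum_le_prod v hv M hM
            (fun i j => hq (x i) q (v k i + j) * x i ^ (Nat.dist j (v l i)))
            (fun i j => mul_nonneg (hq_nonneg _ (hx0 i) (hx1 i) _ _) (pow_nonneg (hx0 i).le _))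
      _ ≤ _ := by
          refine Finset.prod_le_prod (fun i _ => Finset.sum_nonneg fun j _ => ?_) fun i _ => ?_
          · exact mul_nonneg (hq_nonneg _ (hx0 i) (hx1 i) _ _) (pow_nonneg (hx0 i).le _)
          · exact hq_step _ (hx0 i) (hx1 i) _ _ _ _

lemma GG_symm (x : ι → ℝ) (v : κ → ι → ℕ) : (GG x v).transpose = GG x v := by
  ext k l
  simp [GG, Matrix.transpose_apply, Nat.dist_comm]

lemma sum_sq_le (A : Matrix κ κ ℝ) (hA : A.transpose = A) :
    (∑ k, ∑ l, A k l) ^ 2 ≤ Fintype.card κ * ∑ k, ∑ l, (A ^ 2) k l := by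
  have h := sq_sum_le_card_mul_sum_sq (s := (Finset.univ : Finset κ)) (f := fun k => ∑ l, A k l)
  refine h.trans (le_of_eq ?_)
  rw [Finset.card_univ]
  congr 1
  have hs : ∀ a b, A a b = A b a := fun a b => by
    conv_lhs => rw [← hA]
    rfl
  calc ∑ m, (∑ l, A m l) ^ 2 = ∑ m, ∑ k, ∑ l, A k m * A m l := by
        refine Finset.sum_congr rfl fun m _ => ?_
        rw [sq, Finset.sum_mul_sum]
        refine Finset.sum_congr rfl fun k _ => Finset.sum_congr rfl fun l _ => ?_
        rw [hs m k]
    _ = ∑ k, ∑ m, ∑ l, A k m * A m l := Finset.sum_comm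
    _ = ∑ k, ∑ l, ∑ m, A k m * A m l := Finset.sum_congr rfl fun k _ => Finset.sum_comm
    _ = _ := by
        simp only [sq, Matrix.mul_apply]

lemma sum_pow_le (A : Matrix κ κ ℝ) (hA : A.transpose = A) (hA0 : ∀ k l, 0 ≤ A k l) (j : ℕ)
    (N : ℝ) (hN0 : 0 < N) (hN : (Fintype.card κ : ℝ) = N) :
    (1 / N * ∑ k, ∑ l, A k l) ^ (2 ^ j) ≤ 1 / N * ∑ k, ∑ l, (A ^ (2 ^ j)) k l := by
  have h0 : 0 ≤ 1 / N * ∑ k, ∑ l, A k l :=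
    mul_nonneg (by positivity) (Finset.sum_nonneg fun k _ => Finset.sum_nonneg fun l _ => hA0 k l)
  induction j with
  | zero => simp
  | succ j ih =>
    have hs : (A ^ (2 ^ j)).transpose = A ^ (2 ^ j) := by rw [Matrix.transpose_pow, hA]
    have h := sum_sq_le _ hs
    rw [hN] at h
    rw [pow_succ 2 j, pow_mul, pow_mul]
    calc _ ≤ (1 / N * ∑ k, ∑ l, (A ^ (2 ^ j)) k l) ^ 2 := pow_le_pow_left₀ (by positivity) ih 2
      _ = 1 / N ^ 2 * (∑ k, ∑ l, (A ^ (2 ^ j)) k l) ^ 2 := by ring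
      _ ≤ 1 / N ^ 2 * (N * ∑ k, ∑ l, ((A ^ (2 ^ j)) ^ 2) k l) :=
          mul_le_mul_of_nonneg_left h (by positivity)
      _ = _ := by field_simp

lemma main_bound (x : ι → ℝ) (hx0 : ∀ i, 0 < x i) (hx1 : ∀ i, x i < 1) (v : κ → ι → ℕ)
    (hv : Function.Injective v) (M : ℕ) (hM : ∀ k i, v k i < M) (j : ℕ)
    (N : ℝ) (hN0 : 0 < N) (hN : (Fintype.card κ : ℝ) = N) :
    (1 / N * ∑ k, ∑ l, GG x v k l) ^ (2 ^ j)
      ≤ N * ∏ i, Real.cosh (((2 ^ j : ℕ) : ℝ) * tt (x i)) := by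
  refine (sum_pow_le (GG x v) (GG_symm x v)
    (fun k l => Finset.prod_nonneg fun i _ => pow_nonneg (hx0 i).le _) j N hN0 hN).trans ?_
  have h : ∀ k l, (GG x v ^ (2 ^ j)) k l ≤ ∏ i, Real.cosh (((2 ^ j : ℕ) : ℝ) * tt (x i)) := by
    intro k l
    refine (GG_pow_le x hx0 hx1 v hv M hM (2 ^ j) k l).trans ?_
    exact Finset.prod_le_prod (fun i _ => hq_nonneg _ (hx0 i) (hx1 i) _ _) fun i _ => hq_le _ _ _
  calc _ ≤ 1 / N * ∑ k : κ, ∑ l : κ, ∏ i, Real.cosh (((2 ^ j : ℕ) : ℝ) * tt (x i)) := by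
        refine mul_le_mul_of_nonneg_left ?_ (by positivity)
        exact Finset.sum_le_sum fun k _ => Finset.sum_le_sum fun l _ => h k l
    _ = _ := by
        simp only [Finset.sum_const, Finset.card_univ, nsmul_eq_mul, hN]
        field_simp

end mat

lemma bern1 (a : ℝ) (h0 : 0 < a) (h1 : a < 1) (n : ℕ) :
    ((n + 1 : ℕ) : ℝ) ^ (a - 1) * a ≤ ((n + 1 : ℕ) : ℝ) ^ a - (n : ℝ) ^ a := by
  have hn : (0 : ℝ) < ((n + 1 : ℕ) : ℝ) := by positivity
  set m : ℝ := ((n + 1 : ℕ) : ℝ) with hm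
  have hnm : (n : ℝ) = m * (1 + (-1 / m)) := by
    rw [hm]; push_cast; field_simp; ring
  have hm1 : 1 ≤ m := by rw [hm]; push_cast; linarith [(Nat.cast_nonneg n : (0 : ℝ) ≤ n)]
  have hge : -1 ≤ -1 / m := by rw [le_div_iff₀ hn]; linarith
  have hb := rpow_one_add_le_one_add_mul_self hge h0.le h1.le
  rw [hnm, Real.mul_rpow hn.le (by linarith), Real.rpow_sub_one hn.ne']
  have hma : 0 < m ^ a := by positivity
  have := mul_le_mul_of_nonneg_left hb hma.le
  have e : m ^ a * (1 + a * (-1 / m)) = m ^ a - m ^ a / m * a := by ring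
  linarith

lemma bern2 (a : ℝ) (h0 : 0 < a) (h1 : a < 1) (n : ℕ) (hn1 : 1 ≤ n) :
    ((n + 1 : ℕ) : ℝ) ^ (-(a + 1)) * a ≤ (n : ℝ) ^ (-a) - ((n + 1 : ℕ) : ℝ) ^ (-a) := by
  have hb := bern1 a h0 h1 n
  have hn : (0 : ℝ) < (n : ℝ) := by exact_mod_cast hn1
  have hm : (0 : ℝ) < ((n + 1 : ℕ) : ℝ) := by positivity
  have hnm : (n : ℝ) ≤ ((n + 1 : ℕ) : ℝ) := by push_cast; linarith
  have hp := Real.rpow_le_rpow hn.le hnm h0.le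
  have hu : 0 < (n : ℝ) ^ a := by positivity
  have hw : 0 < ((n + 1 : ℕ) : ℝ) ^ a := by positivity
  rw [Real.rpow_neg hn.le, Real.rpow_neg hm.le, Real.rpow_neg hm.le, Real.rpow_add_one hm.ne']
  rw [Real.rpow_sub_one hm.ne'] at hb
  generalize ((n + 1 : ℕ) : ℝ) ^ a = w at *
  generalize (n : ℝ) ^ a = u at *
  generalize ((n + 1 : ℕ) : ℝ) = m at *
  have e : u⁻¹ - w⁻¹ = (w - u) / (u * w) := by field_simp
  rw [e, le_div_iff₀ (by positivity)]
  have h3 : (w * m)⁻¹ * a * (u * w) = (a / m) * u := by field_simp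
  have h4 : w / m * a = (a / m) * w := by field_simp
  rw [h3]
  have h5 : (a / m) * u ≤ (a / m) * w := mul_le_mul_of_nonneg_left hp (by positivity)
  linarith

lemma sum1 (a : ℝ) (h0 : 0 < a) (h1 : a < 1) (Y : ℕ) :
    ∑ n ∈ Finset.Ioc 0 Y, (n : ℝ) ^ (a - 1) ≤ (Y : ℝ) ^ a / a := by
  induction Y with
  | zero => simp; positivity
  | succ Y ih =>
    rw [Finset.sum_Ioc_succ_top (by omega)]
    have := bern1 a h0 h1 Y
    rw [le_div_iff₀ h0] at *
    rw [add_mul]; linarith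

lemma sum2 (a : ℝ) (h0 : 0 < a) (h1 : a < 1) (Y : ℕ) (hY : 1 ≤ Y) (Z : ℕ) :
    ∑ n ∈ Finset.Ioc Y Z, (n : ℝ) ^ (-(a + 1)) ≤ (Y : ℝ) ^ (-a) / a := by
  rcases le_or_gt Y Z with hYZ | hYZ
  · suffices h : ∑ n ∈ Finset.Ioc Y Z, (n : ℝ) ^ (-(a + 1)) ≤ ((Y : ℝ) ^ (-a) - (Z : ℝ) ^ (-a)) / a by
      refine h.trans ?_
      have : 0 ≤ (Z : ℝ) ^ (-a) := by positivity
      gcongr; linarith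
    induction Z, hYZ using Nat.le_induction with
    | base => simp
    | succ Z hZ ih =>
      rw [Finset.sum_Ioc_succ_top (by omega)]
      have := bern2 a h0 h1 Z (by omega)
      rw [le_div_iff₀ h0] at *
      rw [add_mul]; linarith
  · rw [Finset.Ioc_eq_empty (by omega)]; simp; positivity

lemma prime_sum (α : ℝ) (h0 : 3 / 5 ≤ α) (h1 : α < 1) (P : Finset ℕ) (hP : ∀ p ∈ P, 0 < p)
    (Y : ℕ) (hY : 1 ≤ Y) (A B : ℝ) (hA : 0 ≤ A) (hB : 0 ≤ B) :
    ∑ p ∈ P, (if p ≤ Y then A * (p : ℝ) ^ (-α) else B * (p : ℝ) ^ (-(2 * α)))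
      ≤ A * ((Y : ℝ) ^ (1 - α) / (1 - α)) + B * ((Y : ℝ) ^ (1 - 2 * α) * 5) := by
  rw [Finset.sum_ite, ← Finset.mul_sum, ← Finset.mul_sum]
  refine add_le_add (mul_le_mul_of_nonneg_left ?_ hA) (mul_le_mul_of_nonneg_left ?_ hB)
  · refine le_trans ?_ (sum1 (1 - α) (by linarith) (by linarith) Y)
    have e : (1 - α) - 1 = -α := by ring
    rw [e]
    apply Finset.sum_le_sum_of_subset_of_nonneg
    · intro p hp
      simp only [Finset.mem_filter] at hp
      simp only [Finset.mem_Ioc]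
      exact ⟨hP p hp.1, hp.2⟩
    · intros; positivity
  · have h2 := sum2 (2 * α - 1) (by linarith) (by linarith) Y hY (P.sup id)
    have e : -((2 * α - 1) + 1) = -(2 * α) := by ring
    have e' : -(2 * α - 1) = 1 - 2 * α := by ring
    rw [e, e'] at h2
    have h3 : (Y : ℝ) ^ (1 - 2 * α) / (2 * α - 1) ≤ (Y : ℝ) ^ (1 - 2 * α) * 5 := by
      have : 0 < 2 * α - 1 := by linarith
      rw [div_le_iff₀ this]
      have : 0 ≤ (Y : ℝ) ^ (1 - 2 * α) := by positivity
      nlinarith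
    refine le_trans ?_ (h2.trans h3)
    apply Finset.sum_le_sum_of_subset_of_nonneg
    · intro p hp
      simp only [Finset.mem_filter] at hp
      simp only [Finset.mem_Ioc]
      exact ⟨by omega, Finset.le_sup (f := id) hp.1⟩
    · intros; positivity

lemma prod_repr (P : Finset ℕ) (a : ℕ) (ha : 0 < a) (haP : a.primeFactors ⊆ P) :
    (a : ℝ) = ∏ p : P, (((p : ℕ) : ℝ) ^ (a.factorization p)) := by
  have h := Nat.prod_factorization_pow_eq_self ha.ne'
  rw [Finsupp.prod_of_support_subset (s := P) _ (by simpa using haP) _ (by simp)] at h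
  conv_lhs => rw [← h]
  push_cast
  exact (Finset.prod_coe_sort P (fun p => ((p : ℕ) : ℝ) ^ (a.factorization p))).symm

lemma entry (α : ℝ) (P : Finset ℕ) (hP : ∀ p ∈ P, p.Prime) (a b : ℕ) (ha : 0 < a) (hb : 0 < b)
    (haP : a.primeFactors ⊆ P) (hbP : b.primeFactors ⊆ P) :
    (Nat.gcd a b : ℝ) ^ (2 * α) / ((a : ℝ) * (b : ℝ)) ^ α
      = ∏ p : P, (((p : ℕ) : ℝ) ^ (-α)) ^ (Nat.dist (a.factorization p) (b.factorization p)) := by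
  have hg : 0 < Nat.gcd a b := Nat.gcd_pos_of_pos_left _ ha
  have hgP : (Nat.gcd a b).primeFactors ⊆ P :=
    (Nat.primeFactors_mono (Nat.gcd_dvd_left a b) ha.ne').trans haP
  rw [prod_repr P _ hg hgP, prod_repr P a ha haP, prod_repr P b hb hbP,
    ← Finset.prod_mul_distrib, ← Real.finset_prod_rpow _ _ (fun i _ => by positivity),
    ← Real.finset_prod_rpow _ _ (fun i _ => by positivity), ← Finset.prod_div_distrib]
  refine Finset.prod_congr rfl fun p _ => ?_
  have hp : (0 : ℝ) < ((p : ℕ) : ℝ) := by exact_mod_cast (hP p p.2).pos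
  rw [Nat.factorization_gcd ha.ne' hb.ne', Finsupp.inf_apply]
  generalize a.factorization p = u
  generalize b.factorization p = w
  generalize ((p : ℕ) : ℝ) = y at *
  rw [← pow_add, ← Real.rpow_natCast, ← Real.rpow_natCast, ← Real.rpow_natCast,
    ← Real.rpow_mul hp.le, ← Real.rpow_mul hp.le, ← Real.rpow_mul hp.le, ← Real.rpow_sub hp]
  congr 1
  have : 2 * (u ⊓ w) + Nat.dist u w = u + w := by
    unfold Nat.dist
    rcases le_total u w with h | h
    · rw [inf_eq_left.2 h]; omega
    · rw [inf_eq_right.2 h]; omega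
  have : 2 * ((u ⊓ w : ℕ) : ℝ) + (Nat.dist u w : ℝ) = u + w := by exact_mod_cast this
  push_cast at this ⊢
  linear_combination α * this

lemma alpha_ge (α : ℝ) (h : Real.log 2 / Real.log 3 < α) : 3 / 5 ≤ α := by
  refine le_trans ?_ h.le
  rw [div_le_div_iff₀ (by norm_num) (Real.log_pos (by norm_num))]
  have h1 : (3 : ℝ) * Real.log 3 = Real.log (3 ^ 3) := by rw [Real.log_pow]; norm_num
  have h2 : Real.log 2 * 5 = Real.log (2 ^ 5) := by rw [Real.log_pow]; push_cast; ring
  rw [h1, h2]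
  exact Real.log_le_log (by norm_num) (by norm_num)

lemma x_le (α : ℝ) (h : 3 / 5 ≤ α) (p : ℕ) (hp : 2 ≤ p) : (p : ℝ) ^ (-α) ≤ 7 / 10 := by
  have hp' : (2 : ℝ) ≤ p := by exact_mod_cast hp
  calc (p : ℝ) ^ (-α) ≤ (2 : ℝ) ^ (-α) :=
        Real.rpow_le_rpow_of_nonpos (by norm_num) hp' (by linarith)
    _ ≤ (2 : ℝ) ^ (-(3 / 5) : ℝ) := Real.rpow_le_rpow_of_exponent_le (by norm_num) (by linarith)
    _ ≤ 7 / 10 := by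
        refine le_of_pow_le_pow_left₀ (n := 5) (by norm_num) (by norm_num) ?_
        rw [← Real.rpow_natCast, ← Real.rpow_mul (by norm_num)]
        have : (-(3 / 5) : ℝ) * ((5 : ℕ) : ℝ) = -((3 : ℕ) : ℝ) := by norm_num
        rw [this, Real.rpow_neg (by norm_num), Real.rpow_natCast]
        norm_num

lemma numeric (α L q : ℝ) (Y : ℕ) (h0 : 3 / 5 ≤ α) (h1 : α < 1) (hL : 2 / 3 ≤ L)
    (hq1 : L ^ α ≤ q) (hq2 : q ≤ 2 * L ^ α) (hY1 : L ≤ Y) (hY2 : (Y : ℝ) ≤ L + 1) :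
    L + ((q * 7) * ((Y : ℝ) ^ (1 - α) / (1 - α)) + (q * 7) ^ 2 / 2 * ((Y : ℝ) ^ (1 - 2 * α) * 5))
      ≤ q * (300 / (1 - α) * L ^ (1 - α)) := by
  have hLp : 0 < L := by linarith
  have hβ : 0 < 1 - α := by linarith
  have hq0 : 0 < q := lt_of_lt_of_le (by positivity) hq1
  set E := L ^ (1 - α) with hE
  have hE0 : 0 < E := by positivity
  have hEE : L = L ^ α * E := by
    rw [hE, ← Real.rpow_add hLp]; simp
  have hinv : E ≤ E / (1 - α) := by
    rw [le_div_iff₀ hβ]; nlinarith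
  have a1 : L ≤ q * (E / (1 - α)) := by
    calc L = L ^ α * E := hEE
      _ ≤ q * (E / (1 - α)) := by gcongr
  have a2 : (Y : ℝ) ^ (1 - α) ≤ 5 / 2 * E := by
    calc (Y : ℝ) ^ (1 - α) ≤ (5 / 2 * L) ^ (1 - α) :=
          Real.rpow_le_rpow (by positivity) (by linarith) hβ.le
      _ = (5 / 2 : ℝ) ^ (1 - α) * E := Real.mul_rpow (by norm_num) hLp.le
      _ ≤ (5 / 2 : ℝ) ^ (1 : ℝ) * E := by
          gcongr
          · norm_num
          · linarith
      _ = _ := by rw [Real.rpow_one]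
  have a3 : (Y : ℝ) ^ (1 - 2 * α) ≤ L ^ (1 - 2 * α) :=
    Real.rpow_le_rpow_of_nonpos hLp hY1 (by linarith)
  have a4 : L ^ α * L ^ (1 - 2 * α) = E := by
    rw [← Real.rpow_add hLp]; congr 1; ring
  have a5 : q * (Y : ℝ) ^ (1 - 2 * α) ≤ 2 * E := by
    calc q * (Y : ℝ) ^ (1 - 2 * α) ≤ (2 * L ^ α) * L ^ (1 - 2 * α) := by gcongr
      _ = _ := by rw [mul_assoc, a4]
  have b1 : (q * 7) * ((Y : ℝ) ^ (1 - α) / (1 - α)) ≤ (q * 7) * (5 / 2 * E / (1 - α)) := by gcongr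
  have b2 : (q * 7) ^ 2 / 2 * ((Y : ℝ) ^ (1 - 2 * α) * 5) ≤ q * (245 * (E / (1 - α))) := by
    calc _ = q * (49 * 5 / 2 * (q * (Y : ℝ) ^ (1 - 2 * α))) := by ring
      _ ≤ q * (49 * 5 / 2 * (2 * E)) := by gcongr
      _ = q * (245 * E) := by ring
      _ ≤ _ := by gcongr
  have e1 : (q * 7) * (5 / 2 * E / (1 - α)) = 35 / 2 * (q * (E / (1 - α))) := by ring
  have e2 : q * (300 / (1 - α) * E) = 300 * (q * (E / (1 - α))) := by ring
  have e3 : 0 ≤ q * (E / (1 - α)) := by positivity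
  rw [e2]
  rw [e1] at b1
  linarith

end GcdSum

open GcdSum in
/-- **Uniform GCD-sum bound.** There is an absolute constant `C > 0` such that for all
`α ∈ (log 2 / log 3, 1)` and all `N ≥ 2`, for every choice of `N` distinct positive
integers `n_1, …, n_N`,
`(1/N) ∑_{k,ℓ=1}^N gcd(n_k,n_ℓ)^{2α}/(n_k n_ℓ)^α ≤ exp((C/(1-α)) (log N)^{1-α})`. -/
theorem stmt5 :
    ∃ C : ℝ, 0 < C ∧
      ∀ α : ℝ, Real.log 2 / Real.log 3 < α → α < 1 →
        ∀ N : ℕ, 2 ≤ N →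
          ∀ n : Fin N → ℕ, Function.Injective n → (∀ i, 0 < n i) →
            (1 / (N : ℝ)) * ∑ k : Fin N, ∑ l : Fin N,
                (Nat.gcd (n k) (n l) : ℝ) ^ (2 * α) / ((n k : ℝ) * (n l : ℝ)) ^ α
              ≤ Real.exp (C / (1 - α) * Real.log N ^ (1 - α)) := by
  refine ⟨300, by norm_num, ?_⟩
  intro α hα h1 N hN n hinj hpos
  have h0 := alpha_ge α hα
  have hN2 : (2 : ℝ) ≤ N := by exact_mod_cast hN
  have hNp : (0 : ℝ) < N := by linarith
  set L := Real.log N with hLdef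
  have hL : 2 / 3 ≤ L := by
    have := Real.log_le_log (by norm_num) hN2
    have := Real.log_two_gt_d9
    linarith
  have hLp : 0 < L := by linarith
  -- the exponent
  have hLa : 2 / 3 ≤ L ^ α := by
    rcases le_total 1 L with h | h
    · have := Real.one_le_rpow h (by linarith : (0 : ℝ) ≤ α)
      linarith
    · have := Real.rpow_le_rpow_of_exponent_ge hLp h h1.le
      rw [Real.rpow_one] at this
      linarith
  obtain ⟨j, hj1, hj2⟩ := exists_nat_pow_near (show (1 : ℝ) ≤ 2 * L ^ α by linarith)
    (show (1 : ℝ) < 2 by norm_num)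
  rw [pow_succ] at hj2
  -- the primes
  set P : Finset ℕ := Finset.univ.biUnion fun k => (n k).primeFactors with hPdef
  have hP : ∀ p ∈ P, p.Prime := by
    intro p hp
    simp only [hPdef, Finset.mem_biUnion] at hp
    obtain ⟨k, _, hk⟩ := hp
    exact Nat.prime_of_mem_primeFactors hk
  have hsub : ∀ k, (n k).primeFactors ⊆ P := fun k =>
    Finset.subset_biUnion_of_mem (fun k => (n k).primeFactors) (Finset.mem_univ k)
  set x : P → ℝ := fun p => ((p : ℕ) : ℝ) ^ (-α) with hxdef
  set v : Fin N → P → ℕ := fun k p => (n k).factorization p with hvdef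
  have hx0 : ∀ i, 0 < x i := fun i => by
    have : (0 : ℝ) < ((i : ℕ) : ℝ) := by exact_mod_cast (hP i i.2).pos
    exact Real.rpow_pos_of_pos this _
  have hx7 : ∀ i, x i ≤ 7 / 10 := fun i => x_le α h0 i (hP i i.2).two_le
  have hx1 : ∀ i, x i < 1 := fun i => by linarith [hx7 i]
  have hv : Function.Injective v := by
    intro k l hkl
    apply hinj
    have : (n k : ℝ) = n l := by
      rw [prod_repr P _ (hpos k) (hsub k), prod_repr P _ (hpos l) (hsub l)]
      refine Finset.prod_congr rfl fun p _ => ?_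
      have := congrFun hkl p
      simp only [hvdef] at this
      rw [this]
    exact_mod_cast this
  have hM : ∀ k i, v k i < (Finset.univ.sup fun k => Finset.univ.sup (v k)) + 1 := by
    intro k i
    have a1 : v k i ≤ Finset.univ.sup (v k) := Finset.le_sup (Finset.mem_univ i)
    have a2 : Finset.univ.sup (v k) ≤ Finset.univ.sup fun k => Finset.univ.sup (v k) :=
      Finset.le_sup (f := fun k => Finset.univ.sup (v k)) (Finset.mem_univ k)
    omega
  have key := main_bound x hx0 hx1 v hv _ hM j (N : ℝ) hNp (by simp)
  have hent : ∀ k l, (Nat.gcd (n k) (n l) : ℝ) ^ (2 * α) / ((n k : ℝ) * (n l : ℝ)) ^ α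
      = GG x v k l := fun k l =>
    entry α P hP _ _ (hpos k) (hpos l) (hsub k) (hsub l)
  simp only [hent]
  refine le_of_pow_le_pow_left₀ (n := 2 ^ j) (by positivity) (Real.exp_pos _).le ?_
  refine key.trans ?_
  rw [← Real.exp_nat_mul]
  push_cast
  set q : ℝ := 2 ^ j with hqdef
  have hq0 : 0 < q := by positivity
  set Y := ⌈L⌉₊ with hYdef
  have hY1 : L ≤ Y := Nat.le_ceil L
  have hY2 : (Y : ℝ) ≤ L + 1 := (Nat.ceil_lt_add_one hLp.le).le
  have hY : 1 ≤ Y := Nat.one_le_ceil_iff.2 hLp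
  have hnum := numeric α L q Y h0 h1 hL (by linarith) hj1 hY1 hY2
  have hps := prime_sum α h0 h1 P (fun p hp => (hP p hp).pos) Y hY (q * 7) ((q * 7) ^ 2 / 2)
    (by positivity) (by positivity)
  have hcosh : ∀ i : P, Real.cosh (q * tt (x i)) ≤ Real.exp
      (if (i : ℕ) ≤ Y then q * 7 * ((i : ℕ) : ℝ) ^ (-α)
        else (q * 7) ^ 2 / 2 * ((i : ℕ) : ℝ) ^ (-(2 * α))) := by
    intro i
    have ht0 := tt_nonneg (x i) (hx0 i) (hx1 i)
    have ht := tt_le (x i) (hx0 i) (hx7 i)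
    have hu0 : 0 ≤ q * tt (x i) := by positivity
    have hu : q * tt (x i) ≤ q * 7 * x i := by
      rw [mul_assoc]; exact mul_le_mul_of_nonneg_left ht hq0.le
    split_ifs
    · refine le_trans ?_ (Real.exp_le_exp.2 hu)
      rw [Real.cosh_eq]
      have : Real.exp (-(q * tt (x i))) ≤ Real.exp (q * tt (x i)) :=
        Real.exp_le_exp.2 (by linarith)
      linarith
    · refine (Real.cosh_le_exp_half_sq _).trans (Real.exp_le_exp.2 ?_)
      have e : ((i : ℕ) : ℝ) ^ (-(2 * α)) = x i ^ 2 := by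
        rw [← Real.rpow_natCast, hxdef, ← Real.rpow_mul (by positivity)]
        congr 1; push_cast; ring
      rw [e]
      have := pow_le_pow_left₀ hu0 hu 2
      rw [mul_pow (q * 7)] at this
      linarith
  calc (N : ℝ) * ∏ i, Real.cosh (q * tt (x i))
      ≤ Real.exp L * ∏ i : P, Real.exp (if (i : ℕ) ≤ Y then q * 7 * ((i : ℕ) : ℝ) ^ (-α)
        else (q * 7) ^ 2 / 2 * ((i : ℕ) : ℝ) ^ (-(2 * α))) := by
        rw [hLdef, Real.exp_log hNp]
        refine mul_le_mul_of_nonneg_left ?_ hNp.le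
        exact Finset.prod_le_prod (fun i _ => (Real.cosh_pos _).le) fun i _ => hcosh i
    _ = Real.exp (L + ∑ p ∈ P, (if p ≤ Y then q * 7 * (p : ℝ) ^ (-α)
        else (q * 7) ^ 2 / 2 * (p : ℝ) ^ (-(2 * α)))) := by
        rw [← Real.exp_sum, ← Real.exp_add, ← Finset.sum_coe_sort P]
    _ ≤ _ := Real.exp_le_exp.2 (by linarith)
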